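/- arXiv:2503.21031 — 2 statements merged into one kernel-verified Lean document; each statement's English description precedes it below -/
import Mathlib

section
/- Let (Q,P) be a weakly quasi-lattice ordered group and let Λ be a P-graph. If μ,ν ∈ FA(Λ), then there is a finite subset J ⊆ FA(Λ) such that μΛ ∩ νΛ = ⋃_{λ∈J} λΛ. -/
set_option autoImplicit false

/-- The topology on the power set `Set α` obtained by identifying it with the
product `∏ _ : α, Prop` where each (two-point) factor `Prop` carries the
discrete topology. -/
instance powersetTopology (α : Type) : TopologicalSpace (Set α) :=
  @Pi.topologicalSpace α (fun _ => Prop) (fun _ => ⊥)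

/-- The cylinder `Z(K₁;K₂) = {x : K₁ ⊆ x ⊆ K₂ᶜ}`. -/
def cylinder {α : Type} (K₁ K₂ : Set α) : Set (Set α) :=
  {x | K₁ ⊆ x ∧ x ⊆ K₂ᶜ}

/-- The relation `p ≤ r` iff `p * q = r` for some `q ∈ P`. -/
def Submonoid.leftLE {Q : Type} [Group Q] (P : Submonoid Q) (p r : Q) : Prop :=
  ∃ q ∈ P, p * q = r

/-- A weakly quasi-lattice ordered group `(Q,P)`: a group `Q` together with a
subsemigroup `P` containing the unit with `P ∩ P⁻¹ = {e}`, such that any two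
elements of `P` with a common upper bound (for `leftLE`) have a least common
upper bound. -/
structure WQLO (Q : Type) [Group Q] where
  P : Submonoid Q
  inter_inv : ∀ p ∈ P, p⁻¹ ∈ P → p = 1
  lub : ∀ a ∈ P, ∀ b ∈ P, (∃ c ∈ P, P.leftLE a c ∧ P.leftLE b c) →
    ∃ l ∈ P, P.leftLE a l ∧ P.leftLE b l ∧
      ∀ c ∈ P, P.leftLE a c → P.leftLE b c → P.leftLE l c

/-- A (discrete) `P`-graph: a countable small category, presented by its set of
morphisms `Λ` with range map `r`, source map `s` and a composition `mul`
(constrained by the axioms only on composable pairs, i.e. when `s μ = r ν`),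
together with a degree functor `d : Λ → P` satisfying the unique factorisation
property. The units of `Λ` are exactly the elements of the form `r lam`. -/
structure PGraph (Q : Type) [Group Q] (W : WQLO Q) where
  Λ : Type
  countable : Countable Λ
  r : Λ → Λ
  s : Λ → Λ
  mul : Λ → Λ → Λ
  d : Λ → Q
  d_mem : ∀ lam, d lam ∈ W.P
  s_r : ∀ lam, s (r lam) = r lam
  r_r : ∀ lam, r (r lam) = r lam
  s_s : ∀ lam, s (s lam) = s lam
  r_s : ∀ lam, r (s lam) = s lam
  id_mul : ∀ lam, mul (r lam) lam = lam
  mul_id : ∀ lam, mul lam (s lam) = lam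
  r_mul : ∀ mu nu, s mu = r nu → r (mul mu nu) = r mu
  s_mul : ∀ mu nu, s mu = r nu → s (mul mu nu) = s nu
  mul_assoc : ∀ mu nu k, s mu = r nu → s nu = r k →
    mul (mul mu nu) k = mul mu (mul nu k)
  d_unit : ∀ lam, d (r lam) = 1
  d_mul : ∀ mu nu, s mu = r nu → d (mul mu nu) = d mu * d nu
  factor : ∀ lam, ∀ p ∈ W.P, ∀ q ∈ W.P, d lam = p * q →
    ∃! mn : Λ × Λ, s mn.1 = r mn.2 ∧ mul mn.1 mn.2 = lam ∧ d mn.1 = p ∧ d mn.2 = q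

namespace PGraph

variable {Q : Type} [Group Q] {W : WQLO Q} (G : PGraph Q W)

/-- `λΛ = {λμ : μ ∈ Λ, s λ = r μ}`. -/
def cone (lam : G.Λ) : Set G.Λ :=
  {x | ∃ mu, G.s lam = G.r mu ∧ x = G.mul lam mu}

/-- `λE = {λμ : μ ∈ E, s λ = r μ}`. -/
def coneSet (lam : G.Λ) (E : Set G.Λ) : Set G.Λ :=
  {x | ∃ mu ∈ E, G.s lam = G.r mu ∧ x = G.mul lam mu}

/-- `Λ` is finitely aligned at the pair `(μ,ν)`. -/
def FinAlignedAtPair (mu nu : G.Λ) : Prop :=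
  ∃ J : Finset G.Λ, G.cone mu ∩ G.cone nu = ⋃ lam ∈ (J : Set G.Λ), G.cone lam

/-- `Λ` is finitely aligned at `λ`. -/
def FinAlignedAt (lam : G.Λ) : Prop :=
  ∀ mu ∈ G.cone lam, ∀ nu : G.Λ, G.FinAlignedAtPair mu nu

/-- The finitely aligned part `FA(Λ)`. -/
def FA : Set G.Λ := {lam | G.FinAlignedAt lam}

/-- `FAr(Λ) = FA(Λ) ∪ r(FA(Λ))`. -/
def FAr : Set G.Λ := G.FA ∪ G.r '' G.FA

/-- `μ ≼ λ` iff `μν = λ` for some `ν`. -/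
def pre (mu lam : G.Λ) : Prop :=
  ∃ nu, G.s mu = G.r nu ∧ G.mul mu nu = lam

/-- A filter: a nonempty, hereditary and directed subset of `Λ`. -/
def IsFilter (x : Set G.Λ) : Prop :=
  x.Nonempty ∧ (∀ lam mu, G.pre lam mu → mu ∈ x → lam ∈ x) ∧
    ∀ mu ∈ x, ∀ nu ∈ x, ∃ lam ∈ x, G.pre mu lam ∧ G.pre nu lam

/-- The space `ℱΛ` of filters, with the subspace topology from `𝒫(Λ)`. -/
abbrev FilterSpace := {x : Set G.Λ // G.IsFilter x}

/-- `Z_{ℱΛ}(μ;K) = {x ∈ ℱΛ : μ ∈ x ⊆ Λ∖K}`. -/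
def Zf (mu : G.Λ) (K : Set G.Λ) : Set G.FilterSpace :=
  {x | mu ∈ x.1 ∧ x.1 ⊆ Kᶜ}

/-- An ultrafilter: a filter maximal with respect to inclusion. -/
def IsUltrafilter (x : Set G.Λ) : Prop :=
  G.IsFilter x ∧ ∀ y, G.IsFilter y → x ⊆ y → x = y

/-- The path space `PS(Λ)`: filters meeting `FA(Λ)` (as a set of subsets). -/
def PS : Set (Set G.Λ) := {x | G.IsFilter x ∧ (x ∩ G.FA).Nonempty}

/-- The path space as a topological space (subspace of `𝒫(Λ)`). -/
abbrev PSpace := {x : Set G.Λ // x ∈ G.PS}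

/-- The boundary-path space: the closure in `PS(Λ)` of the set of ultrafilters
lying in `PS(Λ)`. -/
def BPS : Set G.PSpace := closure {x : G.PSpace | G.IsUltrafilter x.1}

abbrev BPSpace := {x : G.PSpace // x ∈ G.BPS}

/-- The left shift `λ⁻¹·x = {μ : λμ ∈ x}`. -/
def lshift (lam : G.Λ) (x : Set G.Λ) : Set G.Λ :=
  {mu | G.s lam = G.r mu ∧ G.mul lam mu ∈ x}

/-- The right shift `λ·x = {ζ : ζ ≼ λμ for some μ ∈ x}`. -/
def rshift (lam : G.Λ) (x : Set G.Λ) : Set G.Λ :=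
  {z | ∃ mu ∈ x, G.s lam = G.r mu ∧ G.pre z (G.mul lam mu)}

/-- The action `x·m`: the left shift of `x` by the unique element of
`x ∩ Λ^m` (when it exists). -/
def act (x : Set G.Λ) (m : Q) : Set G.Λ :=
  ⋃ lam ∈ {l ∈ x | G.d l = m}, G.lshift lam x

/-- The domain `D_m = {x ∈ PS(Λ) : x ∩ Λ^m ≠ ∅}` of `T_m`. -/
def Dom (m : Q) : Set (Set G.Λ) := {x ∈ G.PS | ∃ l ∈ x, G.d l = m}

/-- The range `R_m = {x·m : x ∈ D_m}` of `T_m`. -/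
def Ran (m : Q) : Set (Set G.Λ) := {y | ∃ x ∈ G.Dom m, G.act x m = y}

end PGraph

namespace PGraph

variable {Q : Type} [Group Q] {W : WQLO Q} (G : PGraph Q W)

theorem self_mem_cone (lam : G.Λ) : lam ∈ G.cone lam :=
  ⟨G.s lam, (G.r_s lam).symm, (G.mul_id lam).symm⟩

theorem cone_subset_cone {mu lam : G.Λ} (h : lam ∈ G.cone mu) : G.cone lam ⊆ G.cone mu := by
  obtain ⟨a, ha, rfl⟩ := h
  rintro _ ⟨b, hb, rfl⟩
  have hab : G.s a = G.r b := (G.s_mul mu a ha).symm.trans hb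
  exact ⟨G.mul a b, ha.trans (G.r_mul a b hab).symm, G.mul_assoc mu a b ha hab⟩

/-- The finitely aligned part is a right ideal. -/
theorem cone_subset_FA {mu : G.Λ} (h : mu ∈ G.FA) : G.cone mu ⊆ G.FA :=
  fun _ hlam x hx => h x (G.cone_subset_cone hlam hx)

end PGraph

/-- If `μ, ν ∈ FA(Λ)` then there is a finite `J ⊆ FA(Λ)` with
`μΛ ∩ νΛ = ⋃_{λ ∈ J} λΛ`. -/
theorem statement3 {Q : Type} [Group Q] {W : WQLO Q} (G : PGraph Q W)
    (mu nu : G.Λ) (hmu : mu ∈ G.FA) (hnu : nu ∈ G.FA) :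
    ∃ J : Finset G.Λ, (J : Set G.Λ) ⊆ G.FA ∧
      G.cone mu ∩ G.cone nu = ⋃ lam ∈ (J : Set G.Λ), G.cone lam := by
  obtain ⟨J, hJ⟩ := hmu mu (G.self_mem_cone mu) nu
  refine ⟨J, fun lam hlam => G.cone_subset_FA hmu ?_, hJ⟩
  have h : lam ∈ G.cone mu ∩ G.cone nu := by
    rw [hJ]
    exact Set.mem_biUnion hlam (G.self_mem_cone lam)
  exact h.1
end

section
/- Let (Q,P) be a weakly quasi-lattice ordered group and let Λ be a P-graph. If (μ,μ') is a composable pair in Λ with μμ' ∈ FA(Λ), and (w_n) is a sequence converging to w in Z_{ℱΛ}(μ'), then there is a subsequence (w_{n_k}) such that the right shifts μ·w_{n_k} converge to μ·w in Z_{ℱΛ}(μμ'). -/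
set_option autoImplicit false

namespace PGraph

variable {Q : Type} [Group Q] {W : WQLO Q} (G : PGraph Q W)

theorem mem_cone_iff {lam x : G.Λ} : x ∈ G.cone lam ↔ G.pre lam x :=
  ⟨fun ⟨a, ha, hx⟩ => ⟨a, ha, hx.symm⟩, fun ⟨a, ha, hx⟩ => ⟨a, ha, hx.symm⟩⟩

theorem pre_refl (lam : G.Λ) : G.pre lam lam :=
  ⟨G.s lam, (G.r_s lam).symm, G.mul_id lam⟩

variable {G}

theorem pre.trans {a b c : G.Λ} (hab : G.pre a b) (hbc : G.pre b c) : G.pre a c := by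
  obtain ⟨x, hx, rfl⟩ := hab
  obtain ⟨y, hy, rfl⟩ := hbc
  rw [G.s_mul _ _ hx] at hy
  exact ⟨G.mul x y, by rw [G.r_mul _ _ hy, hx], (G.mul_assoc _ _ _ hx hy).symm⟩

theorem pre.r_eq {a b : G.Λ} (hab : G.pre a b) : G.r a = G.r b := by
  obtain ⟨x, hx, rfl⟩ := hab
  exact (G.r_mul _ _ hx).symm

theorem mul_left_cancel {mu a b : G.Λ} (ha : G.s mu = G.r a) (hb : G.s mu = G.r b)
    (h : G.mul mu a = G.mul mu b) : a = b := by
  have hd : G.d b = G.d a := by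
    have := congrArg G.d h
    rw [G.d_mul _ _ ha, G.d_mul _ _ hb] at this
    exact (_root_.mul_left_cancel this).symm
  have := (G.factor (G.mul mu a) (G.d mu) (G.d_mem _) (G.d a) (G.d_mem _)
    (G.d_mul _ _ ha)).unique (y₁ := (mu, a)) (y₂ := (mu, b))
    ⟨ha, rfl, rfl, rfl⟩ ⟨hb, h.symm, rfl, hd⟩
  exact congrArg Prod.snd this

theorem pre.mul_left {mu a b : G.Λ} (ha : G.s mu = G.r a) (hab : G.pre a b) :
    G.pre (G.mul mu a) (G.mul mu b) := by
  obtain ⟨x, hx, rfl⟩ := hab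
  exact ⟨x, by rw [G.s_mul _ _ ha, hx], G.mul_assoc _ _ _ ha hx⟩

theorem pre.of_mul_left {mu a b : G.Λ} (ha : G.s mu = G.r a) (hb : G.s mu = G.r b)
    (h : G.pre (G.mul mu a) (G.mul mu b)) : G.pre a b := by
  obtain ⟨x, hx, hxe⟩ := h
  rw [G.s_mul _ _ ha] at hx
  rw [G.mul_assoc _ _ _ ha hx] at hxe
  exact ⟨x, hx, mul_left_cancel (by rw [G.r_mul _ _ hx, ha]) hb hxe⟩

theorem mul_mem_rshift {mu a : G.Λ} {x : Set G.Λ} (ha : a ∈ x) (h : G.s mu = G.r a) :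
    G.mul mu a ∈ G.rshift mu x :=
  ⟨a, ha, h, G.pre_refl _⟩

theorem mul_mem_rshift_iff {mu a : G.Λ} {x : Set G.Λ} (hx : G.IsFilter x)
    (h : G.s mu = G.r a) : G.mul mu a ∈ G.rshift mu x ↔ a ∈ x :=
  ⟨fun ⟨_, hb, hmb, hp⟩ => hx.2.1 _ _ (hp.of_mul_left h hmb) hb, fun ha => mul_mem_rshift ha h⟩

theorem isFilter_rshift {mu a : G.Λ} {x : Set G.Λ} (hx : G.IsFilter x) (ha : a ∈ x)
    (h : G.s mu = G.r a) : G.IsFilter (G.rshift mu x) := by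
  refine ⟨⟨_, mul_mem_rshift ha h⟩, ?_, ?_⟩
  · rintro z y hzy ⟨b, hb, hmb, hyb⟩
    exact ⟨b, hb, hmb, hzy.trans hyb⟩
  · rintro y ⟨b, hb, hmb, hyb⟩ z ⟨c, hc, hmc, hzc⟩
    obtain ⟨k, hk, hbk, hck⟩ := hx.2.2 b hb c hc
    exact ⟨G.mul mu k, mul_mem_rshift hk (hmb.trans hbk.r_eq),
      hyb.trans (hbk.mul_left hmb), hzc.trans (hck.mul_left hmc)⟩

/-- Membership of `z` in a right shift is decided by finitely many elements of the filter, if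
the filter meets the finitely aligned part after shifting. -/
theorem exists_finset_mem_rshift_iff {mu a : G.Λ} (h : G.s mu = G.r a)
    (hfa : G.mul mu a ∈ G.FA) (z : G.Λ) :
    ∃ F : Finset G.Λ, ∀ x : Set G.Λ, G.IsFilter x → a ∈ x →
      (z ∈ G.rshift mu x ↔ ∃ b ∈ F, b ∈ x) := by
  classical
  obtain ⟨J, hJ⟩ := hfa (G.mul mu a) (G.mem_cone_iff.2 (G.pre_refl _)) z
  have hJ' : ∀ y, G.pre (G.mul mu a) y ∧ G.pre z y ↔ ∃ g ∈ J, G.pre g y := fun y => by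
    simpa [mem_cone_iff] using Set.ext_iff.1 hJ y
  have hfac : ∀ g ∈ J, ∃ b, G.s mu = G.r b ∧ G.mul mu b = g := fun g hg => by
    obtain ⟨c, hc, rfl⟩ := ((hJ' g).2 ⟨g, hg, G.pre_refl g⟩).1
    rw [G.s_mul _ _ h] at hc
    exact ⟨G.mul a c, by rw [G.r_mul _ _ hc, h], (G.mul_assoc _ _ _ h hc).symm⟩
  choose! f hf hfg using hfac
  refine ⟨J.image f, fun x hx ha => ?_⟩
  have key : z ∈ G.rshift mu x ↔ ∃ g ∈ J, g ∈ G.rshift mu x := by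
    constructor
    · rintro ⟨b, hb, hmb, hzb⟩
      obtain ⟨k, hk, hak, hbk⟩ := hx.2.2 a ha b hb
      obtain ⟨g, hg, hgk⟩ := (hJ' (G.mul mu k)).1
        ⟨hak.mul_left h, hzb.trans (hbk.mul_left hmb)⟩
      exact ⟨g, hg, k, hk, hmb.trans hbk.r_eq, hgk⟩
    · rintro ⟨g, hg, hgx⟩
      exact (isFilter_rshift hx ha h).2.1 _ _ ((hJ' g).2 ⟨g, hg, G.pre_refl g⟩).2 hgx
  rw [key]
  constructor
  · rintro ⟨g, hg, hgx⟩
    rw [← hfg g hg, mul_mem_rshift_iff hx (hf g hg)] at hgx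
    exact ⟨f g, Finset.mem_image_of_mem f hg, hgx⟩
  · rintro ⟨b, hb, hbx⟩
    obtain ⟨g, hg, rfl⟩ := Finset.mem_image.1 hb
    refine ⟨g, hg, ?_⟩
    rw [← hfg g hg, mul_mem_rshift_iff hx (hf g hg)]
    exact hbx

end PGraph

theorem tendsto_powerset_iff {α ι : Type} {l : Filter ι} {u : ι → Set α} {x : Set α} :
    Filter.Tendsto u l (nhds x) ↔ ∀ a, ∀ᶠ n in l, (a ∈ u n ↔ a ∈ x) := by
  let _ : TopologicalSpace Prop := ⊥
  have : DiscreteTopology Prop := ⟨rfl⟩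
  refine (tendsto_pi_nhds (A := fun _ : α => Prop) (f := u) (g := x)).trans
    (forall_congr' fun a => ?_)
  rw [nhds_discrete, Filter.tendsto_pure]
  exact Filter.eventually_congr (Filter.Eventually.of_forall fun _ => eq_iff_iff)

/-- If `(μ,μ')` is composable with `μμ' ∈ FA(Λ)` and `w_n → w` in
`Z_{ℱΛ}(μ')`, then there is a subsequence `(w_{n_k})` such that
`μ·w_{n_k} → μ·w` in `Z_{ℱΛ}(μμ')`. -/
theorem statement15 {Q : Type} [Group Q] {W : WQLO Q} (G : PGraph Q W)
    (mu mu' : G.Λ) (hc : G.s mu = G.r mu') (hfa : G.mul mu mu' ∈ G.FA)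
    (w : G.FilterSpace) (hw : mu' ∈ w.1)
    (wseq : ℕ → G.FilterSpace) (hwseq : ∀ n, mu' ∈ (wseq n).1)
    (hconv : Filter.Tendsto wseq Filter.atTop (nhds w)) :
    ∃ φ : ℕ → ℕ, StrictMono φ ∧
    ∃ z : ℕ → G.FilterSpace, ∃ zl : G.FilterSpace,
      (∀ k, (z k).1 = G.rshift mu (wseq (φ k)).1) ∧
      zl.1 = G.rshift mu w.1 ∧
      (∀ k, G.mul mu mu' ∈ (z k).1) ∧ G.mul mu mu' ∈ zl.1 ∧
      Filter.Tendsto z Filter.atTop (nhds zl) := by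
  have hr : ∀ x : G.FilterSpace, mu' ∈ x.1 → G.IsFilter (G.rshift mu x.1) :=
    fun x hx => PGraph.isFilter_rshift x.2 hx hc
  refine ⟨id, strictMono_id, fun n => ⟨_, hr _ (hwseq n)⟩, ⟨_, hr w hw⟩, fun _ => rfl, rfl,
    fun n => PGraph.mul_mem_rshift (hwseq n) hc, PGraph.mul_mem_rshift hw hc, ?_⟩
  rw [tendsto_subtype_rng, tendsto_powerset_iff] at hconv ⊢
  intro z
  obtain ⟨F, hF⟩ := PGraph.exists_finset_mem_rshift_iff hc hfa z
  filter_upwards [(Filter.eventually_all_finset F).2 fun b _ => hconv b] with n hn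
  refine (hF _ (wseq n).2 (hwseq n)).trans (Iff.trans ?_ (hF _ w.2 hw).symm)
  exact exists_congr fun b => and_congr_right fun hb => hn b hb
end
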